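/- Assume there are t_max ∈ ℕ with t_max ≥ 1 and ρ ∈ (0,1) such that t_s ≤ E[τ|cog,a] ≤ t_max and E[γ^τ|cog,a] ≤ ρ for every cog ∈ C and a ∈ A(cog). Suppose the pointwise limit V*(q,cog) = lim_{n→∞} V_n(q,cog) exists for every (q,cog) ∈ ℤ × C. Then for every cog ∈ C, every q ∈ ℤ and every Δ ∈ ℕ: (c·t_s·Δ)/(1 − γ^{t_max}) ≤ V*(q,cog) − V*(q+Δ,cog) ≤ (c·t_max·Δ)/(1 − ρ); in particular, for each fixed cog the map q ↦ V*(q,cog) is nonincreasing. -/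

import Mathlib

open scoped BigOperators

namespace Fidelity

/-- The actions available to the human operator: skip, rest, normal fidelity, high fidelity. -/
inductive Action : Type
  | S | R | N | H
deriving DecidableEq

/-- Admissible action set: `{S, N, H}` for `cog ≤ cog*` and `{S, R, N, H}` for `cog > cog*`. -/
def Act {C : Type*} [LinearOrder C] (cogStar cog : C) : Finset Action :=
  if cog ≤ cogStar then {Action.S, Action.N, Action.H}
  else {Action.S, Action.R, Action.N, Action.H}

lemma Act_nonempty {C : Type*} [LinearOrder C] (cogStar cog : C) :
    (Act cogStar cog).Nonempty := by
  unfold Act; split <;> exact ⟨Action.S, by simp⟩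

/-- The reward `r(a)`: `r(H) = r_H`, `r(N) = r_N`, `r(S) = r(R) = 0`. -/
noncomputable def rew (rH rN : ℝ) : Action → ℝ
  | Action.H => rH
  | Action.N => rN
  | _ => 0

/-- Expected net immediate reward
`R((q,cog),a) = r(a) − c·E[τ|cog,a]·q − (cλ/2)·E[τ²|cog,a]`. -/
noncomputable def Rimm {C : Type*} (c lam rH rN : ℝ) (Etau Etau2 : C → Action → ℝ)
    (q : ℤ) (cog : C) (a : Action) : ℝ :=
  rew rH rN a - c * Etau cog a * (q : ℝ) - c * lam / 2 * Etau2 cog a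

/-- The Poisson probability of `w` arrivals when the mean number of arrivals is `μ`. -/
noncomputable def poissonPMF (μ : ℝ) (w : ℕ) : ℝ :=
  Real.exp (-μ) * μ ^ w / (w.factorial : ℝ)

/-- The next queue length: `q − 1 + w` under actions `S, N, H` and `q + w` under `R`. -/
def nextQ (a : Action) (q : ℤ) (w : ℕ) : ℤ :=
  if a = Action.R then q + (w : ℤ) else q - 1 + (w : ℤ)

/-- `E[γ^τ | cog, a]`, the expected discount over a sojourn in state `cog` under action `a`. -/
noncomputable def Egamma {C : Type*} [Fintype C] (γ : ℝ) (P : C → Action → ℕ → C → ℝ)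
    (cog : C) (a : Action) : ℝ :=
  ∑' (τ : ℕ), ∑' (cog' : C), γ ^ τ * P cog a τ cog'

/-- The Q-value of action `a` at `(q, cog)` for the continuation value function `V`:
`Q_V(q,cog,a) = R((q,cog),a) + Σ_{τ,cog',w} γ^τ·P(τ,cog'|cog,a)·Poisson(λτ)(w)·V(q',cog')`. -/
noncomputable def Qval {C : Type*} [Fintype C] (c lam rH rN γ : ℝ)
    (Etau Etau2 : C → Action → ℝ) (P : C → Action → ℕ → C → ℝ)
    (V : ℤ → C → ℝ) (q : ℤ) (cog : C) (a : Action) : ℝ :=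
  Rimm c lam rH rN Etau Etau2 q cog a +
    ∑' (τ : ℕ), ∑' (cog' : C), ∑' (w : ℕ),
      γ ^ τ * P cog a τ cog' * poissonPMF (lam * (τ : ℝ)) w * V (nextQ a q w) cog'

/-- The `n`-step optimal value functions: `V_0(q,cog) = −C₀·q` and
`V_{n+1}(q,cog) = max_{a ∈ A(cog)} Q_{V_n}(q,cog,a)`. -/
noncomputable def Vn {C : Type*} [LinearOrder C] [Fintype C] (cogStar : C)
    (c lam rH rN γ C0 : ℝ) (Etau Etau2 : C → Action → ℝ)
    (P : C → Action → ℕ → C → ℝ) : ℕ → ℤ → C → ℝ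
  | 0, q, _ => -C0 * (q : ℝ)
  | n + 1, q, cog =>
      (Act cogStar cog).sup' (Act_nonempty cogStar cog) fun a =>
        Qval c lam rH rN γ Etau Etau2 P
          (Vn cogStar c lam rH rN γ C0 Etau Etau2 P n) q cog a

lemma poissonPMF_nonneg {μ : ℝ} (hμ : 0 ≤ μ) (w : ℕ) : 0 ≤ poissonPMF μ w := by
  unfold poissonPMF; positivity

lemma hasSum_poissonPMF (μ : ℝ) : HasSum (poissonPMF μ) 1 := by
  have h := (NormedSpace.expSeries_div_hasSum_exp μ).mul_left (Real.exp (-μ))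
  rw [← Real.exp_eq_exp_ℝ, ← Real.exp_add, neg_add_cancel, Real.exp_zero] at h
  refine (congrArg (HasSum · _) (funext fun w => ?_)).mpr h
  exact mul_div_assoc _ _ _

lemma hasSum_mul_poissonPMF (μ : ℝ) : HasSum (fun w : ℕ => (w : ℝ) * poissonPMF μ w) μ := by
  rw [← hasSum_nat_add_iff' 1]
  have h := (hasSum_poissonPMF μ).mul_left μ
  simp only [Finset.range_one, Finset.sum_singleton, Nat.cast_zero, zero_mul, sub_zero]
  rw [mul_one] at h
  refine (congrArg (HasSum · _) (funext fun w => ?_)).mpr h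
  unfold poissonPMF
  rw [Nat.factorial_succ]
  push_cast
  field_simp
  ring

lemma hasSum_poissonPMF_affine (μ A B : ℝ) :
    HasSum (fun w : ℕ => poissonPMF μ w * (A + B * w)) (A + B * μ) := by
  have h := ((hasSum_poissonPMF μ).mul_left A).add ((hasSum_mul_poissonPMF μ).mul_left B)
  rw [mul_one] at h
  refine (congrArg (HasSum · _) (funext fun w => ?_)).mpr h
  ring

lemma summable_poissonPMF_mul {μ A B : ℝ} (hμ : 0 ≤ μ) {f : ℕ → ℝ}
    (hf : ∀ w, |f w| ≤ A + B * w) : Summable fun w => poissonPMF μ w * f w := by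
  refine Summable.of_norm_bounded (hasSum_poissonPMF_affine μ A B).summable fun w => ?_
  rw [Real.norm_eq_abs, abs_mul, abs_of_nonneg (poissonPMF_nonneg hμ w)]
  exact mul_le_mul_of_nonneg_left (hf w) (poissonPMF_nonneg hμ w)

lemma abs_tsum_poissonPMF_mul_le {μ A B : ℝ} (hμ : 0 ≤ μ) {f : ℕ → ℝ}
    (hf : ∀ w, |f w| ≤ A + B * w) : |∑' w, poissonPMF μ w * f w| ≤ A + B * μ := by
  rw [← Real.norm_eq_abs]
  refine tsum_of_norm_bounded (hasSum_poissonPMF_affine μ A B) fun w => ?_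
  rw [Real.norm_eq_abs, abs_mul, abs_of_nonneg (poissonPMF_nonneg hμ w)]
  exact mul_le_mul_of_nonneg_left (hf w) (poissonPMF_nonneg hμ w)

lemma tsum_poissonPMF_mul_le {μ A B A' B' d : ℝ} (hμ : 0 ≤ μ) {f g : ℕ → ℝ}
    (hf : ∀ w, |f w| ≤ A + B * w) (hg : ∀ w, |g w| ≤ A' + B' * w) (h : ∀ w, f w ≤ g w + d) :
    ∑' w, poissonPMF μ w * f w ≤ (∑' w, poissonPMF μ w * g w) + d := by
  have h1 := (summable_poissonPMF_mul hμ hg).hasSum.add ((hasSum_poissonPMF μ).mul_right d)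
  rw [one_mul] at h1
  refine hasSum_le (fun w => ?_) (summable_poissonPMF_mul hμ hf).hasSum h1
  rw [← mul_add]
  exact mul_le_mul_of_nonneg_left (h w) (poissonPMF_nonneg hμ w)

/-- The expected discounted continuation value is summable over the sojourn time, for
continuation values of at most linear growth in the number of arrivals. -/
lemma summable_continuation {C : Type*} [Fintype C] {lam γ : ℝ} (hlam : 0 ≤ lam)
    (hγ0 : 0 ≤ γ) (hγ1 : γ ≤ 1) {p : ℕ → C → ℝ} (hp : ∀ τ x, 0 ≤ p τ x)
    (hs0 : Summable fun τ => ∑ x, p τ x) (hs1 : Summable fun τ : ℕ => (τ : ℝ) * ∑ x, p τ x)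
    {f : ℕ → C → ℝ} {A B : ℝ} (hf : ∀ w x, |f w x| ≤ A + B * w) :
    Summable fun τ : ℕ => ∑ x, γ ^ τ * p τ x * ∑' w, poissonPMF (lam * τ) w * f w x := by
  refine Summable.of_norm_bounded ((hs0.mul_left A).add (hs1.mul_left (B * lam))) fun τ => ?_
  have hμ : 0 ≤ lam * (τ : ℝ) := by positivity
  have hdiv : A * ∑ x, p τ x + B * lam * (τ * ∑ x, p τ x)
      = ∑ x, p τ x * (A + B * (lam * τ)) := by
    rw [← Finset.sum_mul]; ring
  rw [hdiv]
  refine (norm_sum_le _ _).trans (Finset.sum_le_sum fun x _ => ?_)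
  rw [Real.norm_eq_abs, abs_mul, abs_mul, abs_of_nonneg (hp τ x),
    abs_of_nonneg (pow_nonneg hγ0 τ)]
  refine mul_le_mul ?_ (abs_tsum_poissonPMF_mul_le hμ fun w => hf w x) (abs_nonneg _) (hp τ x)
  exact mul_le_of_le_one_left (hp τ x) (pow_le_one₀ hγ0 hγ1)

lemma summable_discount {C : Type*} [Fintype C] {γ : ℝ}
    (hγ0 : 0 ≤ γ) (hγ1 : γ ≤ 1) {p : ℕ → C → ℝ} (hp : ∀ τ x, 0 ≤ p τ x)
    (hs0 : Summable fun τ => ∑ x, p τ x) : Summable fun τ => ∑ x, γ ^ τ * p τ x := by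
  refine Summable.of_nonneg_of_le
    (fun τ => Finset.sum_nonneg fun x _ => mul_nonneg (pow_nonneg hγ0 τ) (hp τ x))
    (fun τ => Finset.sum_le_sum fun x _ => ?_) hs0
  exact mul_le_of_le_one_left (hp τ x) (pow_le_one₀ hγ0 hγ1)

lemma continuation_le {C : Type*} [Fintype C] {lam γ : ℝ} (hlam : 0 ≤ lam)
    (hγ0 : 0 ≤ γ) (hγ1 : γ ≤ 1) {p : ℕ → C → ℝ} (hp : ∀ τ x, 0 ≤ p τ x)
    (hs0 : Summable fun τ => ∑ x, p τ x) (hs1 : Summable fun τ : ℕ => (τ : ℝ) * ∑ x, p τ x)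
    {f g : ℕ → C → ℝ} {A B A' B' d : ℝ} (hf : ∀ w x, |f w x| ≤ A + B * w)
    (hg : ∀ w x, |g w x| ≤ A' + B' * w) (h : ∀ w x, f w x ≤ g w x + d) :
    (∑' τ : ℕ, ∑' x, ∑' w, γ ^ τ * p τ x * poissonPMF (lam * τ) w * f w x) ≤
      (∑' τ : ℕ, ∑' x, ∑' w, γ ^ τ * p τ x * poissonPMF (lam * τ) w * g w x) +
        d * ∑' τ : ℕ, ∑' x, γ ^ τ * p τ x := by
  have pull : ∀ (k μ : ℝ) (u : ℕ → ℝ),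
      ∑' w, k * poissonPMF μ w * u w = k * ∑' w, poissonPMF μ w * u w := fun k μ u => by
    simp only [mul_assoc, tsum_mul_left]
  simp only [tsum_fintype, pull]
  have hF := summable_continuation hlam hγ0 hγ1 hp hs0 hs1 hf
  have hG := summable_continuation hlam hγ0 hγ1 hp hs0 hs1 hg
  have hD := summable_discount hγ0 hγ1 hp hs0
  refine hasSum_le (fun τ => ?_) hF.hasSum (hG.hasSum.add (hD.hasSum.mul_left d))
  rw [Finset.mul_sum, ← Finset.sum_add_distrib]
  refine Finset.sum_le_sum fun x _ => ?_
  have hμ : 0 ≤ lam * (τ : ℝ) := by positivity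
  have h1 := mul_le_mul_of_nonneg_left
    (tsum_poissonPMF_mul_le hμ (fun w => hf w x) (fun w => hg w x) fun w => h w x)
    (mul_nonneg (pow_nonneg hγ0 τ) (hp τ x))
  linarith

/-- Jensen's inequality for the discount: if the mean sojourn is at most `T`, the expected
discount is at least `γ ^ T`. -/
lemma pow_le_tsum_discount {C : Type*} [Fintype C] {γ : ℝ} (hγ0 : 0 < γ) (hγ1 : γ ≤ 1)
    {p : ℕ → C → ℝ} (hp : ∀ τ x, 0 ≤ p τ x) (hs0 : Summable fun τ => ∑ x, p τ x)
    (hs1 : Summable fun τ : ℕ => (τ : ℝ) * ∑ x, p τ x) (hsum : ∑' τ, ∑ x, p τ x = 1) (T : ℕ)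
    (hT : ∑' τ : ℕ, (τ : ℝ) * ∑ x, p τ x ≤ T) : γ ^ T ≤ ∑' τ, ∑ x, γ ^ τ * p τ x := by
  have hlog : Real.log γ ≤ 0 := Real.log_nonpos hγ0.le hγ1
  have key : ∀ τ : ℕ, γ ^ T * (1 + (τ - T) * Real.log γ) ≤ γ ^ τ := fun τ => by
    have hpow : ∀ n : ℕ, γ ^ n = Real.exp (n * Real.log γ) := fun n => by
      rw [Real.exp_nat_mul, Real.exp_log hγ0]
    have hτ : γ ^ τ = γ ^ T * Real.exp ((τ - T) * Real.log γ) := by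
      rw [hpow, hpow, ← Real.exp_add]; ring_nf
    rw [hτ, add_comm]
    exact mul_le_mul_of_nonneg_left (Real.add_one_le_exp _) (pow_nonneg hγ0.le T)
  have h0 := hs0.hasSum.mul_left (γ ^ T * (1 - T * Real.log γ))
  have h1 := hs1.hasSum.mul_left (γ ^ T * Real.log γ)
  have hle := hasSum_le (fun τ : ℕ => ?_) (h0.add h1) (summable_discount hγ0.le hγ1 hp hs0).hasSum
  · rw [hsum] at hle
    refine le_trans ?_ hle
    have hneg := mul_nonneg_of_nonpos_of_nonpos hlog (sub_nonpos.2 hT)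
    have := mul_nonneg (pow_nonneg hγ0.le T) hneg
    linarith
  · have h2 := mul_le_mul_of_nonneg_right (key τ)
      (Finset.sum_nonneg fun x (_ : x ∈ Finset.univ) => hp τ x)
    rw [← Finset.mul_sum]
    refine le_trans (le_of_eq ?_) h2
    ring

lemma nextQ_add (a : Action) (q d : ℤ) (w : ℕ) : nextQ a (q + d) w = nextQ a q w + d := by
  unfold nextQ; split <;> ring

/-- A function on `ℤ` whose increments over `Δ` lie between `-u * Δ` and `0` grows linearly. -/
lemma abs_le_of_increments {f : ℤ → ℝ} {l u : ℝ} (hl : 0 ≤ l)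
    (h : ∀ (q : ℤ) (Δ : ℕ), l * Δ ≤ f q - f (q + Δ) ∧ f q - f (q + Δ) ≤ u * Δ) (q : ℤ) :
    |f q| ≤ |f 0| + u * |(q : ℝ)| := by
  have hd : |f q - f 0| ≤ u * |(q : ℝ)| := by
    obtain ⟨n, rfl | rfl⟩ := q.eq_nat_or_neg
    · have h1 := h 0 n
      have : 0 ≤ l * (n : ℝ) := by positivity
      simp only [zero_add] at h1
      rw [abs_sub_comm, abs_of_nonneg (by linarith)]
      simpa using h1.2
    · have h1 := h (-n) n
      have : 0 ≤ l * (n : ℝ) := by positivity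
      simp only [neg_add_cancel] at h1
      rw [abs_of_nonneg (by linarith)]
      simpa using h1.2
  have := abs_sub_abs_le_abs_sub (f q) (f 0)
  linarith

lemma abs_comp_nextQ_le {C : Type*} [Fintype C] {V : ℤ → C → ℝ} {l u : ℝ} (hl : 0 ≤ l)
    (hu : 0 ≤ u) (h : ∀ (x : C) (q : ℤ) (Δ : ℕ),
      l * Δ ≤ V q x - V (q + Δ) x ∧ V q x - V (q + Δ) x ≤ u * Δ) (a : Action) (q : ℤ)
    (w : ℕ) (x : C) :
    |V (nextQ a q w) x| ≤ ((∑ y, |V 0 y|) + u * (|(q : ℝ)| + 1)) + u * w := by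
  have h1 := abs_le_of_increments (f := fun q => V q x) hl (h x) (nextQ a q w)
  have h2 : |V 0 x| ≤ ∑ y, |V 0 y| :=
    Finset.single_le_sum (f := fun y => |V 0 y|) (fun y _ => abs_nonneg _) (Finset.mem_univ x)
  have h3 : |((nextQ a q w : ℤ) : ℝ)| ≤ |(q : ℝ)| + 1 + w := by
    have hw : (0 : ℝ) ≤ w := w.cast_nonneg
    have ha := neg_abs_le (q : ℝ)
    have hb := le_abs_self (q : ℝ)
    unfold nextQ
    split <;> push_cast <;> rw [abs_le] <;> constructor <;> linarith
  have h4 := mul_le_mul_of_nonneg_left h3 hu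
  linarith

/-- value-function bounds, Lemma 3: if `t_s ≤ E[τ|cog,a] ≤ t_max` and
`E[γ^τ|cog,a] ≤ ρ` for all admissible pairs, and `V*(q,cog) = lim_n V_n(q,cog)` exists
pointwise, then `(c·t_s·Δ)/(1−γ^{t_max}) ≤ V*(q,cog) − V*(q+Δ,cog) ≤ (c·t_max·Δ)/(1−ρ)`;
in particular `q ↦ V*(q,cog)` is nonincreasing. -/
theorem stmt8 {C : Type*} [LinearOrder C] [Fintype C]
    (cogStar : C) (c lam rH rN γ : ℝ) (ts : ℕ)
    (Etau Etau2 : C → Action → ℝ) (P : C → Action → ℕ → C → ℝ)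
    (hc : 0 < c) (hlam : 0 < lam) (hγ : γ ∈ Set.Ioo (0 : ℝ) 1)
    (hrN : 0 ≤ rN) (hrHN : rN < rH) (hts : 1 ≤ ts)
    (hPnn : ∀ cog a τ cog', 0 ≤ P cog a τ cog')
    (hP0 : ∀ cog a cog', P cog a 0 cog' = 0)
    (hPsum : ∀ cog, ∀ a ∈ Act cogStar cog, (∑' (τ : ℕ), ∑' (cog' : C), P cog a τ cog') = 1)
    (hPS : ∀ cog τ cog', τ ≠ ts → P cog Action.S τ cog' = 0)
    (hEtau : ∀ cog a, Etau cog a = ∑' (τ : ℕ), ∑' (cog' : C), (τ : ℝ) * P cog a τ cog')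
    (hEtau2 : ∀ cog a, Etau2 cog a = ∑' (τ : ℕ), ∑' (cog' : C), (τ : ℝ) ^ 2 * P cog a τ cog')
    (hMom2 : ∀ cog a, Summable fun τ : ℕ => (τ : ℝ) ^ 2 * ∑' (cog' : C), P cog a τ cog')
    (tmax : ℕ) (htmax : 1 ≤ tmax) (ρ : ℝ) (hρ : ρ ∈ Set.Ioo (0 : ℝ) 1)
    (hEle : ∀ cog, ∀ a ∈ Act cogStar cog, Etau cog a ≤ (tmax : ℝ))
    (hEts : ∀ cog, ∀ a ∈ Act cogStar cog, (ts : ℝ) ≤ Etau cog a)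
    (hEg : ∀ cog, ∀ a ∈ Act cogStar cog, Egamma γ P cog a ≤ ρ)
    (C0 : ℝ) (hC0 : 0 ≤ C0)
    (Vstar : ℤ → C → ℝ)
    (hlim : ∀ (q : ℤ) (cog : C),
      Filter.Tendsto (fun n => Vn cogStar c lam rH rN γ C0 Etau Etau2 P n q cog)
        Filter.atTop (nhds (Vstar q cog))) :
    (∀ (cog : C) (q : ℤ) (Δ : ℕ),
      c * (ts : ℝ) * (Δ : ℝ) / (1 - γ ^ tmax) ≤ Vstar q cog - Vstar (q + (Δ : ℤ)) cog ∧
        Vstar q cog - Vstar (q + (Δ : ℤ)) cog ≤ c * (tmax : ℝ) * (Δ : ℝ) / (1 - ρ)) ∧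
    ∀ cog : C, Antitone fun q : ℤ => Vstar q cog := by
  obtain ⟨hγ0, hγ1⟩ := hγ
  obtain ⟨hρ0, hρ1⟩ := hρ
  simp only [tsum_fintype] at hPsum hEtau hMom2
  have hs1 : ∀ cog a, Summable fun τ : ℕ => (τ : ℝ) * ∑ x, P cog a τ x := fun cog a => by
    have hnn : ∀ τ, 0 ≤ ∑ x, P cog a τ x := fun τ => Finset.sum_nonneg fun x _ => hPnn cog a τ x
    refine Summable.of_nonneg_of_le (fun τ => mul_nonneg τ.cast_nonneg (hnn τ)) (fun τ => ?_)
      (hMom2 cog a)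
    refine mul_le_mul_of_nonneg_right ?_ (hnn τ)
    exact_mod_cast Nat.le_self_pow two_ne_zero τ
  have hs0 : ∀ cog, ∀ a ∈ Act cogStar cog, Summable fun τ : ℕ => ∑ x, P cog a τ x :=
    fun cog a ha => by
      by_contra hns
      have := hPsum cog a ha
      rw [tsum_eq_zero_of_not_summable hns] at this
      exact zero_ne_one this
  have hEtau' : ∀ cog a, Etau cog a = ∑' τ : ℕ, (τ : ℝ) * ∑ x, P cog a τ x := fun cog a => by
    simp only [hEtau, Finset.mul_sum]
  have hEg' : ∀ cog, ∀ a ∈ Act cogStar cog, γ ^ tmax ≤ Egamma γ P cog a := fun cog a ha => by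
    unfold Egamma
    simp only [tsum_fintype]
    exact pow_le_tsum_discount hγ0 hγ1.le (hPnn cog a) (hs0 cog a ha) (hs1 cog a)
      (hPsum cog a ha) tmax (hEtau' cog a ▸ hEle cog a ha)
  have hβ0 : 0 ≤ γ ^ tmax := pow_nonneg hγ0.le _
  have hβ1 : γ ^ tmax < 1 := pow_lt_one₀ hγ0.le hγ1 (by omega)
  have hρ' : 0 < 1 - ρ := by linarith
  have hβ' : 0 < 1 - γ ^ tmax := by linarith
  set K : ℝ := c * tmax / (1 - ρ) with hK
  set M : ℝ := c * ts / (1 - γ ^ tmax) with hM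
  have hK0 : 0 ≤ K := by positivity
  have hM0 : 0 ≤ M := by positivity
  have hKeq : c * tmax = K * (1 - ρ) := by rw [hK]; field_simp
  have hMeq : c * ts = M * (1 - γ ^ tmax) := by rw [hM]; field_simp
  have bounds : ∀ (n : ℕ) (x : C) (q : ℤ) (Δ : ℕ),
      M * (1 - (γ ^ tmax) ^ n) * Δ ≤
          Vn cogStar c lam rH rN γ C0 Etau Etau2 P n q x
            - Vn cogStar c lam rH rN γ C0 Etau Etau2 P n (q + Δ) x ∧
        Vn cogStar c lam rH rN γ C0 Etau Etau2 P n q x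
            - Vn cogStar c lam rH rN γ C0 Etau Etau2 P n (q + Δ) x ≤
          (K * (1 - ρ ^ n) + ρ ^ n * C0) * Δ := by
    intro n
    induction n with
    | zero =>
      intro x q Δ
      have : 0 ≤ C0 * (Δ : ℝ) := by positivity
      simp only [Vn, pow_zero]
      push_cast
      constructor <;> linarith
    | succ n ih =>
      intro x q Δ
      have hl : 0 ≤ M * (1 - (γ ^ tmax) ^ n) :=
        mul_nonneg hM0 (sub_nonneg.2 (pow_le_one₀ hβ0 hβ1.le))
      have hu : 0 ≤ K * (1 - ρ ^ n) + ρ ^ n * C0 :=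
        add_nonneg (mul_nonneg hK0 (sub_nonneg.2 (pow_le_one₀ hρ0.le hρ1.le))) (by positivity)
      set l := M * (1 - (γ ^ tmax) ^ n) with hldef
      set u := K * (1 - ρ ^ n) + ρ ^ n * C0 with hudef
      have hl' : M * (1 - (γ ^ tmax) ^ (n + 1)) = c * ts + γ ^ tmax * l := by
        rw [hMeq, hldef]; ring
      have hu' : K * (1 - ρ ^ (n + 1)) + ρ ^ (n + 1) * C0 = c * tmax + ρ * u := by
        rw [hKeq, hudef]; ring
      rw [hl', hu']
      simp only [Vn]
      set V := Vn cogStar c lam rH rN γ C0 Etau Etau2 P n with hV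
      have growth := abs_comp_nextQ_le hl hu ih
      have hΔ : (0 : ℝ) ≤ Δ := Δ.cast_nonneg
      have hQ : ∀ a ∈ Act cogStar x,
          Qval c lam rH rN γ Etau Etau2 P V (q + Δ) x a + (c * ts + γ ^ tmax * l) * Δ ≤
              Qval c lam rH rN γ Etau Etau2 P V q x a ∧
            Qval c lam rH rN γ Etau Etau2 P V q x a ≤
              Qval c lam rH rN γ Etau Etau2 P V (q + Δ) x a + (c * tmax + ρ * u) * Δ := by
        intro a ha
        have h1 := continuation_le (d := u * Δ) hlam.le hγ0.le hγ1.le (hPnn x a) (hs0 x a ha)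
          (hs1 x a) (growth a q) (growth a (q + Δ)) fun w y => by
            rw [nextQ_add]; linarith [(ih y (nextQ a q w) Δ).2]
        have h2 := continuation_le (d := -(l * Δ)) hlam.le hγ0.le hγ1.le (hPnn x a) (hs0 x a ha)
          (hs1 x a) (growth a (q + Δ)) (growth a q) fun w y => by
            rw [nextQ_add]; linarith [(ih y (nextQ a q w) Δ).1]
        have e1 := hEg x a ha
        have e2 := hEg' x a ha
        unfold Egamma at e1 e2
        have m1 := mul_le_mul_of_nonneg_left e1 (mul_nonneg hu hΔ)
        have m2 := mul_le_mul_of_nonneg_left e2 (mul_nonneg hl hΔ)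
        have m3 := mul_le_mul_of_nonneg_left (hEle x a ha) (mul_nonneg hc.le hΔ)
        have m4 := mul_le_mul_of_nonneg_left (hEts x a ha) (mul_nonneg hc.le hΔ)
        simp only [Qval, Rimm]
        push_cast at h1 h2 ⊢
        constructor <;> linarith
      constructor
      · rw [le_sub_iff_add_le', ← le_sub_iff_add_le]
        refine Finset.sup'_le _ _ fun a ha => ?_
        rw [le_sub_iff_add_le]
        exact (hQ a ha).1.trans (Finset.le_sup' (Qval c lam rH rN γ Etau Etau2 P V q x) ha)
      · rw [sub_le_iff_le_add']
        refine Finset.sup'_le _ _ fun a ha => (hQ a ha).2.trans ?_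
        gcongr
        exact Finset.le_sup' (Qval c lam rH rN γ Etau Etau2 P V (q + Δ) x) ha
  have main : ∀ (cog : C) (q : ℤ) (Δ : ℕ),
      c * (ts : ℝ) * (Δ : ℝ) / (1 - γ ^ tmax) ≤ Vstar q cog - Vstar (q + (Δ : ℤ)) cog ∧
        Vstar q cog - Vstar (q + (Δ : ℤ)) cog ≤ c * (tmax : ℝ) * (Δ : ℝ) / (1 - ρ) := by
    intro x q Δ
    have hd := (hlim q x).sub (hlim (q + Δ) x)
    have tβ := tendsto_pow_atTop_nhds_zero_of_lt_one hβ0 hβ1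
    have tρ := tendsto_pow_atTop_nhds_zero_of_lt_one hρ0.le hρ1
    have tl := ((tβ.const_sub 1).const_mul M).mul_const (Δ : ℝ)
    have tu := (((tρ.const_sub 1).const_mul K).add (tρ.mul_const C0)).mul_const (Δ : ℝ)
    have h1 := le_of_tendsto_of_tendsto' tl hd fun n => (bounds n x q Δ).1
    have h2 := le_of_tendsto_of_tendsto' hd tu fun n => (bounds n x q Δ).2
    rw [mul_div_right_comm, mul_div_right_comm (c * (tmax : ℝ))]
    constructor
    · simpa using h1
    · simpa using h2
  refine ⟨main, fun x q q' hqq' => ?_⟩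
  obtain ⟨n, rfl⟩ := Int.le.dest hqq'
  have h := (main x q n).1
  have : 0 ≤ c * (ts : ℝ) * (n : ℝ) / (1 - γ ^ tmax) := by positivity
  simp only
  linarith

end Fidelity
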